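/- Assume E is the maximal A-order in D, i.e., E equals the integral closure of A in D. Then every nonzero ideal of E is a kernel ideal. -/

import Mathlib

/- Framework: Drinfeld modules over a finite A-field `k`, realized concretely.
`k{τ}` is the subring of additive endomorphisms of an algebraic closure of `k`
generated by the `q`-power Frobenius `τ` and multiplications by elements of `k`. -/

open Polynomial

noncomputable section

namespace Drinfeld

variable (p m : ℕ) [Fact p.Prime]
variable (Fq k : Type) [Field Fq] [Fintype Fq] [Field k] [Fintype k] [CharP k p]

/-- A fixed algebraic closure of `k`. -/
abbrev Kb := AlgebraicClosure k

variable (hFq : Fintype.card Fq = p ^ m)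

/-- The `q`-power Frobenius `τ : x ↦ x^q` as an additive endomorphism of `Kb k`. -/
def tau : AddMonoid.End (Kb k) where
  toFun x := x ^ Fintype.card Fq
  map_zero' := zero_pow Fintype.card_ne_zero
  map_add' x y := by
    haveI : CharP (Kb k) p :=
      charP_of_injective_algebraMap (algebraMap k (Kb k)).injective p
    simp only [hFq]
    exact add_pow_char_pow x y p m

/-- Multiplication by `c ∈ k` as an additive endomorphism of `Kb k`. -/
def ml (c : k) : AddMonoid.End (Kb k) :=
  AddMonoidHom.mulLeft (algebraMap k (Kb k) c)

/-- The twisted polynomial ring `k{τ}`. -/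
def skewPoly : Subring (AddMonoid.End (Kb k)) :=
  Subring.closure (insert (tau p m Fq k hFq) (Set.range (ml k)))

/-- The additive endomorphism `Σᵢ cᵢ ∘ τ^i` attached to a finitely supported
family of coefficients `c : ℕ →₀ k`. -/
def ofCoeffs (c : ℕ →₀ k) : AddMonoid.End (Kb k) :=
  c.sum fun i a => ml k a * tau p m Fq k hFq ^ i

/-- A Drinfeld module of rank `r` over the `A`-field `(k, γ)`:
a ring homomorphism `φ : A = Fq[T] → k{τ}` with
`φ_a = γ(a) + g₁(a) τ + ⋯ + g_{r·deg a}(a) τ^{r·deg a}` and `g_{r · deg a}(a) ≠ 0`. -/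
structure DrinfeldModule (γ : Polynomial Fq →+* k) (r : ℕ) : Type where
  toRingHom : Polynomial Fq →+* AddMonoid.End (Kb k)
  coeffs : Polynomial Fq → ℕ →₀ k
  eq_ofCoeffs : ∀ a, toRingHom a = ofCoeffs p m Fq k hFq (coeffs a)
  coeff_zero : ∀ a, coeffs a 0 = γ a
  coeff_top : ∀ a, a ≠ 0 → coeffs a (r * a.natDegree) ≠ 0
  coeff_eq_zero : ∀ a i, r * a.natDegree < i → coeffs a i = 0

variable {γ : Polynomial Fq →+* k} {r : ℕ}

/-- The endomorphism ring `End_k(φ)`: the centralizer of `φ(A)` in `k{τ}`. -/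
def EndRing (φ : DrinfeldModule p m Fq k hFq γ r) : Subring (AddMonoid.End (Kb k)) :=
  skewPoly p m Fq k hFq ⊓ Subring.centralizer (Set.range ⇑φ.toRingHom)

/-- `u` is an isogeny `φ → ψ`: a nonzero element of `k{τ}` with `u φ_a = ψ_a u`. -/
def IsIsogeny (φ ψ : DrinfeldModule p m Fq k hFq γ r) (u : AddMonoid.End (Kb k)) : Prop :=
  u ≠ 0 ∧ u ∈ skewPoly p m Fq k hFq ∧ ∀ a, u * φ.toRingHom a = ψ.toRingHom a * u

/-- Two Drinfeld modules are isomorphic when some isogeny between them lies in `k^×`. -/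
def Isomorphic (φ ψ : DrinfeldModule p m Fq k hFq γ r) : Prop :=
  ∃ c : k, c ≠ 0 ∧ ∀ a, ml k c * φ.toRingHom a = ψ.toRingHom a * ml k c

/-- The left ideal `k{τ}·s` of `k{τ}` generated by a subset `s`. -/
def leftSpan (s : Set (AddMonoid.End (Kb k))) : AddSubgroup (AddMonoid.End (Kb k)) :=
  AddSubgroup.closure {y | ∃ w ∈ skewPoly p m Fq k hFq, ∃ x ∈ s, y = w * x}

/-- `u` generates the left ideal `k{τ}·s` of `k{τ}`: `k{τ}s = k{τ}u`.
(Such a `u = u_I` exists by the right division algorithm in `k{τ}`.) -/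
def IsIdealGen (s : Set (AddMonoid.End (Kb k))) (u : AddMonoid.End (Kb k)) : Prop :=
  u ∈ skewPoly p m Fq k hFq ∧
    (leftSpan p m Fq k hFq s : Set (AddMonoid.End (Kb k))) =
      {y | ∃ w ∈ skewPoly p m Fq k hFq, y = w * u}

/-- `I` is an ideal of the (commutative) subring `E` of `k{τ}`. -/
def IsIdealOf (E : Subring (AddMonoid.End (Kb k))) (I : Set (AddMonoid.End (Kb k))) : Prop :=
  I ⊆ E ∧ (0 : AddMonoid.End (Kb k)) ∈ I ∧
    (∀ x ∈ I, ∀ y ∈ I, x + y ∈ I) ∧ (∀ x ∈ I, -x ∈ I) ∧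
    (∀ e ∈ E, ∀ x ∈ I, e * x ∈ I) ∧ (∀ e ∈ E, ∀ x ∈ I, x * e ∈ I)

/-- Membership in `D = End_k(φ) ⊗_A F = Frac(End_k(φ))` for an element of `k{τ}`:
`x ∈ D` iff `x·φ_a ∈ End_k(φ)` for some nonzero `a ∈ A`, i.e. `x = e/φ_a`. -/
def MemD (φ : DrinfeldModule p m Fq k hFq γ r) (x : AddMonoid.End (Kb k)) : Prop :=
  ∃ a : Polynomial Fq, a ≠ 0 ∧ x * φ.toRingHom a ∈ EndRing p m Fq k hFq φ

/-- `I` is a kernel ideal: `(k{τ}I) ∩ D = I`. -/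
def IsKernelIdeal (φ : DrinfeldModule p m Fq k hFq γ r)
    (I : Set (AddMonoid.End (Kb k))) : Prop :=
  {x | x ∈ leftSpan p m Fq k hFq I ∧ MemD p m Fq k hFq φ x} = I

/-- The subring `A[π] = φ(A)[π]` of `k{τ}`, where `π = τ^n` is the Frobenius of `k`. -/
def ApirOp (n : ℕ) (φ : DrinfeldModule p m Fq k hFq γ r) :
    Subring (AddMonoid.End (Kb k)) :=
  Subring.closure (insert (tau p m Fq k hFq ^ n) (Set.range ⇑φ.toRingHom))

/-- `φ` has height `H` (relative to the monic generator `P` of `𝔭 = ker γ`):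
the smallest `τ`-degree of a nonzero term of `φ_P` equals `H · deg P`, i.e. `φ_P` is
right-divisible by `τ^{H·deg P}` but not by `τ^{H·deg P + 1}`. -/
def HasHeight (φ : DrinfeldModule p m Fq k hFq γ r) (P : Polynomial Fq) (H : ℕ) : Prop :=
  (∃ u ∈ skewPoly p m Fq k hFq,
      φ.toRingHom P = u * tau p m Fq k hFq ^ (H * P.natDegree)) ∧
    ¬∃ u ∈ skewPoly p m Fq k hFq,
      φ.toRingHom P = u * tau p m Fq k hFq ^ (H * P.natDegree + 1)

/-- `I = J·u` for some nonzero `u ∈ D = Frac(E)`, written as `u = e/φ_a` with `e ∈ E`,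
`a ∈ A` both nonzero; equivalently `I·φ_a = J·e`. -/
def LinEquiv (φ : DrinfeldModule p m Fq k hFq γ r) (E : Subring (AddMonoid.End (Kb k)))
    (I J : Set (AddMonoid.End (Kb k))) : Prop :=
  ∃ e ∈ E, e ≠ 0 ∧ ∃ a : Polynomial Fq, a ≠ 0 ∧
    (fun x => x * φ.toRingHom a) '' I = (fun y => y * e) '' J

/-- The additive polynomial `u(X) ∈ k[X]` attached to `u ∈ k{τ}` (the unique polynomial
inducing `u` on the algebraic closure, if it exists; junk value `0` otherwise). -/
def toPoly (u : AddMonoid.End (Kb k)) : Polynomial k :=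
  letI := Classical.propDecidable (∃ P : Polynomial k, ∀ x : Kb k, Polynomial.aeval x P = u x)
  if h : ∃ P : Polynomial k, ∀ x : Kb k, Polynomial.aeval x P = u x then h.choose else 0

end Drinfeld

section DedekindDomain

variable {A R : Type*} [CommRing A] [IsDomain A] [CommRing R] [IsDomain R] [Algebra A R]

/-- A domain that is a finite faithful algebra over a one-dimensional Noetherian domain `A` is a
Dedekind domain as soon as it contains every fraction `e / a` with `a ∈ A` that is integral
over `A`. -/
theorem isDedekindDomain_of_integral_fractions_mem [IsNoetherianRing A] [Ring.DimensionLEOne A]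
    [Module.Finite A R]
    (h : ∀ (e : R) (a : A), a ≠ 0 →
      (∃ N : ℕ, 0 < N ∧ ∃ c : ℕ → A, e ^ N + ∑ i ∈ Finset.range N,
        algebraMap A R (c i) * e ^ i * algebraMap A R a ^ (N - i) = 0) →
      algebraMap A R a ∣ e) (hinj : Function.Injective (algebraMap A R)) :
    IsDedekindDomain R := by
  have hdim : Ring.DimensionLEOne R := Ring.DimensionLEOne.of_isIntegral A R
  rw [isDedekindDomain_iff R (FractionRing R)]
  refine ⟨inferInstance, IsNoetherianRing.of_finite A R, hdim, fun {x} hx => ?_⟩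
  have hxA : IsIntegral A x := isIntegral_trans x hx
  obtain ⟨u, v, hv, rfl⟩ := IsFractionRing.div_surjective (A := R) x
  obtain ⟨a, ha, t, ht⟩ :=
    (Algebra.IsIntegral.isIntegral (R := A) v).isAlgebraic.exists_nonzero_dvd hv
  obtain ⟨f, hf, hfx⟩ := hxA
  have ha' : algebraMap A R a ≠ 0 := by
    rwa [Ne, map_eq_zero_iff _ hinj]
  have hKinj := IsFractionRing.injective R (FractionRing R)
  have hv0 : algebraMap R (FractionRing R) v ≠ 0 := by
    rw [Ne, map_eq_zero_iff _ hKinj]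
    exact nonZeroDivisors.ne_zero hv
  set x := algebraMap R (FractionRing R) u / algebraMap R (FractionRing R) v with hxdef
  have hxa : x * algebraMap R (FractionRing R) (algebraMap A R a) =
      algebraMap R (FractionRing R) (u * t) := by
    rw [ht, map_mul, map_mul, hxdef]
    field_simp
  have hdeg : 0 < f.natDegree := by
    by_contra hN
    have hf1 : f = 1 := hf.natDegree_eq_zero.mp (by omega)
    simp [hf1] at hfx
  obtain ⟨s, hs⟩ := h (u * t) a ha ⟨f.natDegree, hdeg, f.coeff, hKinj <| by
    rw [Polynomial.eval₂_eq_sum_range, Finset.sum_range_succ, hf.coeff_natDegree, map_one,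
      one_mul, add_comm] at hfx
    simp only [map_add, map_sum, map_mul (algebraMap R (FractionRing R)) (_ * _), map_pow,
      map_mul (algebraMap R (FractionRing R)) (algebraMap A R _), map_zero]
    rw [← hxa, ← zero_mul (algebraMap R (FractionRing R) (algebraMap A R a) ^ f.natDegree),
      ← hfx, add_mul, Finset.sum_mul, mul_pow]
    congr 1
    refine Finset.sum_congr rfl fun i hi => ?_
    rw [← Nat.sub_add_cancel (Finset.mem_range.mp hi).le, Nat.add_sub_cancel, pow_add,
      IsScalarTower.algebraMap_apply A R (FractionRing R)]
    ring⟩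
  refine ⟨s, ?_⟩
  have ha'' : algebraMap R (FractionRing R) (algebraMap A R a) ≠ 0 := by
    rwa [Ne, map_eq_zero_iff _ hKinj]
  apply mul_right_cancel₀ ha''
  rw [hxa, hs, map_mul, mul_comm]

end DedekindDomain

namespace Drinfeld

section SkewPolynomials

variable {p m : ℕ} [Fact p.Prime] {Fq k : Type} [Field Fq] [Fintype Fq]
  [Field k] [CharP k p] {hFq : Fintype.card Fq = p ^ m}

theorem mul_apply (f g : AddMonoid.End (Kb k)) (x : Kb k) : (f * g) x = f (g x) := rfl

theorem ml_apply (c : k) (x : Kb k) : ml k c x = algebraMap k (Kb k) c * x := rfl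

theorem tau_apply (x : Kb k) : tau p m Fq k hFq x = x ^ Fintype.card Fq := rfl

theorem tau_pow_apply (i : ℕ) (x : Kb k) :
    (tau p m Fq k hFq ^ i) x = x ^ Fintype.card Fq ^ i := by
  induction i with
  | zero => simp
  | succ i ih => rw [pow_succ', mul_apply, ih, tau_apply, ← pow_mul, pow_succ]

theorem ml_zero : ml k 0 = 0 := by
  ext x; simp [ml_apply]

theorem ml_one : ml k 1 = 1 := by
  ext x; simp [ml_apply]

theorem ml_add (a b : k) : ml k (a + b) = ml k a + ml k b := by
  ext x; exact (congrArg (· * x) (map_add _ a b)).trans (add_mul _ _ _)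

theorem ml_neg (a : k) : ml k (-a) = -ml k a := by
  ext x; exact (congrArg (· * x) (map_neg _ a)).trans (neg_mul _ _)

theorem monomial_mul_monomial (a b : k) (i j : ℕ) :
    (ml k a * tau p m Fq k hFq ^ i) * (ml k b * tau p m Fq k hFq ^ j) =
      ml k (a * b ^ Fintype.card Fq ^ i) * tau p m Fq k hFq ^ (j + i) := by
  ext x
  simp only [mul_apply, ml_apply, tau_pow_apply, map_mul,
    map_pow, mul_pow, pow_add, mul_assoc]
  rw [pow_right_comm]

theorem monomial_mem_skewPoly (a : k) (i : ℕ) :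
    ml k a * tau p m Fq k hFq ^ i ∈ skewPoly p m Fq k hFq :=
  mul_mem (Subring.subset_closure (Set.mem_insert_of_mem _ ⟨a, rfl⟩))
    (pow_mem (Subring.subset_closure (Set.mem_insert _ _)) i)

theorem ofCoeffs_mem_skewPoly (c : ℕ →₀ k) :
    ofCoeffs p m Fq k hFq c ∈ skewPoly p m Fq k hFq :=
  Subring.sum_mem (skewPoly p m Fq k hFq) fun i _ => monomial_mem_skewPoly (c i) i

theorem ofCoeffs_apply (c : ℕ →₀ k) (x : Kb k) :
    ofCoeffs p m Fq k hFq c x =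
      ∑ i ∈ c.support, algebraMap k (Kb k) (c i) * x ^ Fintype.card Fq ^ i := by
  refine (AddMonoidHom.finsetSum_apply
    (fun i => (ml k (c i) * tau p m Fq k hFq ^ i : AddMonoid.End (Kb k))) c.support x).trans ?_
  refine Finset.sum_congr rfl fun i _ => ?_
  exact congrArg (algebraMap k (Kb k) (c i) * ·) (tau_pow_apply i x)

theorem skewPoly_subset_closure_monomials {x : AddMonoid.End (Kb k)}
    (hx : x ∈ skewPoly p m Fq k hFq) :
    x ∈ AddSubgroup.closure
      (Set.range fun y : k × ℕ => ml k y.1 * tau p m Fq k hFq ^ y.2) := by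
  rw [skewPoly, Subring.mem_closure_iff] at hx
  refine AddSubgroup.closure_mono (fun y hy => ?_) hx
  induction hy using Submonoid.closure_induction with
  | mem y hy =>
    rcases hy with rfl | ⟨a, rfl⟩
    · exact ⟨(1, 1), by simp [ml_one]⟩
    · exact ⟨(a, 0), by simp⟩
  | one => exact ⟨(1, 0), by simp [ml_one]⟩
  | mul y z _ _ hy hz =>
    obtain ⟨⟨a, i⟩, rfl⟩ := hy
    obtain ⟨⟨b, j⟩, rfl⟩ := hz
    exact ⟨(_, _), (monomial_mul_monomial a b i j).symm⟩

theorem exists_ofCoeffs_eq {x : AddMonoid.End (Kb k)} (hx : x ∈ skewPoly p m Fq k hFq) :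
    ∃ c, ofCoeffs p m Fq k hFq c = x := by
  have h := skewPoly_subset_closure_monomials hx
  clear hx
  induction h using AddSubgroup.closure_induction with
  | mem y hy =>
    obtain ⟨⟨a, i⟩, rfl⟩ := hy
    exact ⟨Finsupp.single i a, Finsupp.sum_single_index (by simp [ml_zero])⟩
  | zero => exact ⟨0, Finsupp.sum_zero_index⟩
  | add y z _ _ hy hz =>
    obtain ⟨c, rfl⟩ := hy
    obtain ⟨d, rfl⟩ := hz
    exact ⟨c + d, Finsupp.sum_add_index' (by simp [ml_zero]) (by simp [ml_add, add_mul])⟩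
  | neg y _ hy =>
    obtain ⟨c, rfl⟩ := hy
    refine ⟨-c, ?_⟩
    ext z
    refine Eq.trans ?_ (AddMonoidHom.neg_apply _ z).symm
    refine Eq.trans ?_ (congrArg Neg.neg (ofCoeffs_apply c z)).symm
    simp [ofCoeffs_apply]

theorem ofCoeffs_surjective {c : ℕ →₀ k} (hc : c ≠ 0) :
    Function.Surjective (ofCoeffs p m Fq k hFq c) := by
  intro y
  have hq : 1 < Fintype.card Fq := Fintype.one_lt_card
  let P : Polynomial (Kb k) := c.sum fun i a =>
    Polynomial.monomial (Fintype.card Fq ^ i) (algebraMap k (Kb k) a)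
  have hcoeff (i : ℕ) : P.coeff (Fintype.card Fq ^ i) = algebraMap k (Kb k) (c i) := by
    simp only [P, Finsupp.sum, Polynomial.finsetSum_coeff, Polynomial.coeff_monomial,
      (Nat.pow_right_injective hq).eq_iff]
    rw [Finset.sum_ite_eq' c.support i]
    split_ifs with h
    · rfl
    · rw [Finsupp.notMem_support_iff.mp h, map_zero]
  have heval (x : Kb k) : P.eval x = ofCoeffs p m Fq k hFq c x := by
    simp only [P, ofCoeffs_apply, Finsupp.sum, Polynomial.eval_finsetSum, Polynomial.eval_monomial]
  obtain ⟨i, hi⟩ := Finsupp.ne_iff.mp hc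
  have hdeg : (P - Polynomial.C y).degree ≠ 0 := by
    intro h
    have h0 : (P - Polynomial.C y).coeff (Fintype.card Fq ^ i) = 0 :=
      Polynomial.coeff_eq_zero_of_degree_lt (h ▸ by
        exact_mod_cast Nat.pow_pos (zero_lt_one.trans hq))
    rw [Polynomial.coeff_sub, hcoeff, Polynomial.coeff_C_of_ne_zero
      (Nat.pow_pos (zero_lt_one.trans hq)).ne', sub_zero] at h0
    exact hi (by simpa using h0)
  obtain ⟨x, hx⟩ := IsAlgClosed.exists_root _ hdeg
  refine ⟨x, ?_⟩
  rw [← heval]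
  simpa [sub_eq_zero] using hx

theorem ofCoeffs_ne_zero {c : ℕ →₀ k} (hc : c ≠ 0) : ofCoeffs p m Fq k hFq c ≠ 0 := by
  intro h
  obtain ⟨x, hx⟩ := ofCoeffs_surjective (hFq := hFq) hc 1
  simp [h] at hx

theorem eq_zero_of_mul_eq_zero_left {x y : AddMonoid.End (Kb k)}
    (hy : y ∈ skewPoly p m Fq k hFq) (hy0 : y ≠ 0) (h : x * y = 0) : x = 0 := by
  obtain ⟨c, rfl⟩ := exists_ofCoeffs_eq hy
  have hc : c ≠ 0 := by
    rintro rfl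
    exact hy0 Finsupp.sum_zero_index
  ext z
  obtain ⟨w, rfl⟩ := ofCoeffs_surjective (hFq := hFq) hc z
  exact DFunLike.congr_fun h w

/-- If `y ≠ 0` and `x * y` both centralize `S`, and `y ∈ k{τ}`, then `x` centralizes `S`. -/
theorem mem_centralizer_of_mul_mem {S : Set (AddMonoid.End (Kb k))} {x y : AddMonoid.End (Kb k)}
    (hy : y ∈ skewPoly p m Fq k hFq) (hy0 : y ≠ 0) (hyS : y ∈ Subring.centralizer S)
    (hxy : x * y ∈ Subring.centralizer S) : x ∈ Subring.centralizer S := by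
  rw [Subring.mem_centralizer_iff] at *
  intro g hg
  rw [← sub_eq_zero]
  refine eq_zero_of_mul_eq_zero_left hy hy0 ?_
  rw [sub_mul, mul_assoc, hxy g hg, mul_assoc, mul_assoc, hyS g hg, sub_self]

theorem leftSpan_subset_skewPoly {s : Set (AddMonoid.End (Kb k))}
    (hs : s ⊆ skewPoly p m Fq k hFq) {x : AddMonoid.End (Kb k)}
    (hx : x ∈ leftSpan p m Fq k hFq s) : x ∈ skewPoly p m Fq k hFq := by
  induction hx using AddSubgroup.closure_induction with
  | mem y hy => obtain ⟨w, hw, z, hz, rfl⟩ := hy; exact mul_mem hw (hs hz)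
  | zero => exact zero_mem _
  | add y z _ _ hy hz => exact add_mem hy hz
  | neg y _ hy => exact neg_mem hy

/-- Right multiplication by `y` maps `k{τ} I` into `k{τ} e` whenever it maps `I` there. -/
theorem exists_mul_eq_mul_of_mem_leftSpan {s : Set (AddMonoid.End (Kb k))}
    {y e : AddMonoid.End (Kb k)}
    (h : ∀ x ∈ s, ∃ w ∈ skewPoly p m Fq k hFq, x * y = w * e) {x : AddMonoid.End (Kb k)}
    (hx : x ∈ leftSpan p m Fq k hFq s) : ∃ w ∈ skewPoly p m Fq k hFq, x * y = w * e := by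
  induction hx using AddSubgroup.closure_induction with
  | mem z hz =>
    obtain ⟨w, hw, x, hx, rfl⟩ := hz
    obtain ⟨v, hv, hxy⟩ := h x hx
    exact ⟨w * v, mul_mem hw hv, by rw [mul_assoc, hxy, mul_assoc]⟩
  | zero => exact ⟨0, zero_mem _, by rw [zero_mul, zero_mul]⟩
  | add u v _ _ hu hv =>
    obtain ⟨w, hw, hu⟩ := hu
    obtain ⟨w', hw', hv⟩ := hv
    exact ⟨w + w', add_mem hw hw', by rw [add_mul, hu, hv, add_mul]⟩
  | neg u _ hu =>
    obtain ⟨w, hw, hu⟩ := hu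
    exact ⟨-w, neg_mem hw, (neg_mul u y).trans ((congrArg Neg.neg hu).trans (neg_mul w e).symm)⟩

end SkewPolynomials

section DrinfeldModule

variable {p m : ℕ} [Fact p.Prime] {Fq k : Type} [Field Fq] [Fintype Fq]
  [Field k] [CharP k p] {hFq : Fintype.card Fq = p ^ m}
  {γ : Polynomial Fq →+* k} {r : ℕ} (φ : DrinfeldModule p m Fq k hFq γ r)

theorem DrinfeldModule.toRingHom_ne_zero {a : Polynomial Fq} (ha : a ≠ 0) :
    φ.toRingHom a ≠ 0 := by
  rw [φ.eq_ofCoeffs]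
  refine ofCoeffs_ne_zero fun h => φ.coeff_top a ha ?_
  rw [h, Finsupp.zero_apply]

theorem DrinfeldModule.toRingHom_mem_endRing (a : Polynomial Fq) :
    φ.toRingHom a ∈ EndRing p m Fq k hFq φ := by
  refine ⟨φ.eq_ofCoeffs a ▸ ofCoeffs_mem_skewPoly _, ?_⟩
  rintro _ ⟨b, rfl⟩
  rw [← map_mul, mul_comm, map_mul]

/-- If `x * y ∈ End_k(φ)` with `0 ≠ y ∈ End_k(φ)` and `x ∈ k{τ}` then `x ∈ End_k(φ)`. -/
theorem mem_endRing_of_mul_mem {x y : AddMonoid.End (Kb k)}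
    (hx : x ∈ skewPoly p m Fq k hFq) (hy : y ∈ EndRing p m Fq k hFq φ) (hy0 : y ≠ 0)
    (hxy : x * y ∈ EndRing p m Fq k hFq φ) : x ∈ EndRing p m Fq k hFq φ :=
  ⟨hx, mem_centralizer_of_mul_mem hy.1 hy0 hy.2 hxy.2⟩

theorem isDomain_endRing : IsDomain (EndRing p m Fq k hFq φ) := by
  have : Nontrivial (EndRing p m Fq k hFq φ) := ⟨0, 1, fun h => one_ne_zero (α := Kb k)
    (DFunLike.congr_fun (congrArg Subtype.val h) 1).symm⟩
  have : NoZeroDivisors (EndRing p m Fq k hFq φ) := ⟨fun {x y} h => by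
    refine or_iff_not_imp_right.mpr fun hy => Subtype.ext ?_
    exact eq_zero_of_mul_eq_zero_left y.2.1 (fun h0 => hy (Subtype.ext h0))
      (congrArg Subtype.val h)⟩
  exact NoZeroDivisors.to_isDomain _

theorem DrinfeldModule.rank_pos [Finite k] (φ : DrinfeldModule p m Fq k hFq γ r) : 0 < r := by
  rw [Nat.pos_iff_ne_zero]
  rintro rfl
  obtain ⟨a, b, hγ, hab⟩ : ∃ a b, γ a = γ b ∧ a ≠ b := by
    simpa [Function.Injective] using not_injective_infinite_finite γ
  apply φ.coeff_top (a - b) (sub_ne_zero.mpr hab)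
  rw [zero_mul, φ.coeff_zero, map_sub, hγ, sub_self]

/-- `φ` as a homomorphism to the opposite ring, so that `A` acts by right multiplication. -/
def DrinfeldModule.toOpposite : Polynomial Fq →+* (AddMonoid.End (Kb k))ᵐᵒᵖ :=
  φ.toRingHom.toOpposite fun a b => by
    rw [commute_iff_eq, ← map_mul, mul_comm, map_mul]

/-- For the action of `A` by right multiplication through `φ`, the ring `k{τ}` is contained in
the submodule generated by the monomials of degree less than the rank. -/
theorem skewPoly_subset_span [Finite k] :
    letI := Module.compHom (AddMonoid.End (Kb k)) φ.toOpposite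
    ∀ x ∈ skewPoly p m Fq k hFq, x ∈ Submodule.span (Polynomial Fq)
      (Set.range fun y : k × Fin r => ml k y.1 * tau p m Fq k hFq ^ (y.2 : ℕ)) := by
  let := Module.compHom (AddMonoid.End (Kb k)) φ.toOpposite
  intro x hx
  set N := Submodule.span (Polynomial Fq)
    (Set.range fun y : k × Fin r => ml k y.1 * tau p m Fq k hFq ^ (y.2 : ℕ))
  have hmon (d : ℕ) : ∀ a : k, ml k a * tau p m Fq k hFq ^ d ∈ N := by
    induction d using Nat.strong_induction_on with
    | _ d ih =>
      intro a
      rcases lt_or_ge d r with hd | hd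
      · exact Submodule.subset_span ⟨(a, ⟨d, hd⟩), rfl⟩
      · set g := φ.coeffs Polynomial.X
        have hr := φ.rank_pos
        have hgr : g r ≠ 0 := by
          simpa using φ.coeff_top Polynomial.X Polynomial.X_ne_zero
        set b := a / g r ^ Fintype.card Fq ^ (d - r) with hb
        have hmem := N.smul_mem Polynomial.X (ih (d - r) (by omega) b)
        change ml k b * tau p m Fq k hFq ^ (d - r) * φ.toRingHom Polynomial.X ∈ N at hmem
        rw [φ.eq_ofCoeffs, ofCoeffs, Finsupp.sum, Finset.mul_sum,
          ← Finset.add_sum_erase _ _ (Finsupp.mem_support_iff.mpr hgr),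
          monomial_mul_monomial, hb,
          div_mul_cancel₀ _ (pow_ne_zero _ hgr), Nat.add_sub_cancel' hd] at hmem
        refine (N.add_mem_iff_left (N.sum_mem fun i hi => ?_)).mp hmem
        rw [monomial_mul_monomial]
        refine ih _ ?_ _
        obtain ⟨hir, hi⟩ := Finset.mem_erase.mp hi
        have hi' : i ≤ r := by
          by_contra hlt
          exact Finsupp.mem_support_iff.mp hi
            (φ.coeff_eq_zero Polynomial.X i (by simpa using hlt))
        omega
  refine (AddSubgroup.closure_le N.toAddSubgroup).mpr ?_ (skewPoly_subset_closure_monomials hx)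
  rintro _ ⟨⟨a, d⟩, rfl⟩
  exact hmon d a

variable (hcomm : ∀ x ∈ EndRing p m Fq k hFq φ, ∀ y ∈ EndRing p m Fq k hFq φ, x * y = y * x)

/-- The commutative ring structure on `End_k(φ)`, when multiplication commutes. -/
abbrev endCommRing : CommRing (EndRing p m Fq k hFq φ) :=
  { (inferInstance : Ring (EndRing p m Fq k hFq φ)) with
    mul_comm := fun x y => Subtype.ext (hcomm x x.2 y y.2) }

/-- The `A`-algebra structure on `End_k(φ)` given by `φ`. -/
abbrev endAlgebra :
    letI := endCommRing φ hcomm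
    Algebra (Polynomial Fq) (EndRing p m Fq k hFq φ) :=
  letI := endCommRing φ hcomm
  (φ.toRingHom.codRestrict (EndRing p m Fq k hFq φ) φ.toRingHom_mem_endRing).toAlgebra

theorem finite_endRing [Finite k] :
    letI := endCommRing φ hcomm
    letI := endAlgebra φ hcomm
    Module.Finite (Polynomial Fq) (EndRing p m Fq k hFq φ) := by
  let := endCommRing φ hcomm
  let := endAlgebra φ hcomm
  let := Module.compHom (AddMonoid.End (Kb k)) φ.toOpposite
  let N := Submodule.span (Polynomial Fq)
    (Set.range fun y : k × Fin r => ml k y.1 * tau p m Fq k hFq ^ (y.2 : ℕ))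
  have : IsNoetherian (Polynomial Fq) N :=
    isNoetherian_span_of_finite _ (Set.finite_range _)
  let f : EndRing p m Fq k hFq φ →ₗ[Polynomial Fq] N :=
    { toFun := fun x => ⟨x, skewPoly_subset_span φ x x.2.1⟩
      map_add' := fun _ _ => rfl
      map_smul' := fun a x => Subtype.ext
        (hcomm _ (φ.toRingHom_mem_endRing a) x x.2) }
  exact Module.Finite.of_injective f fun x y h => Subtype.ext (congrArg (fun z : N => z.1) h)

theorem isDedekindDomain_endRing [Finite k]
    (hmax : ∀ e ∈ EndRing p m Fq k hFq φ, ∀ a : Polynomial Fq, a ≠ 0 →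
      (∃ N : ℕ, 0 < N ∧ ∃ c : ℕ → Polynomial Fq,
        e ^ N + ∑ i ∈ Finset.range N,
          φ.toRingHom (c i) * e ^ i * φ.toRingHom a ^ (N - i) = 0) →
      ∃ e' ∈ EndRing p m Fq k hFq φ, e = e' * φ.toRingHom a) :
    letI := endCommRing φ hcomm
    IsDedekindDomain (EndRing p m Fq k hFq φ) := by
  let := endCommRing φ hcomm
  let := endAlgebra φ hcomm
  have : IsDomain (EndRing p m Fq k hFq φ) := isDomain_endRing φ
  have := finite_endRing φ hcomm
  refine isDedekindDomain_of_integral_fractions_mem (A := Polynomial Fq) ?_ ?_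
  · rintro e a ha ⟨N, hN, c, h⟩
    obtain ⟨e', he', h'⟩ := hmax e e.2 a ha ⟨N, hN, c, by
      have := congrArg (EndRing p m Fq k hFq φ).subtype h
      rw [map_add, map_sum] at this
      exact this⟩
    exact ⟨⟨e', he'⟩, Subtype.ext (h'.trans (hcomm _ he' _ (φ.toRingHom_mem_endRing a)))⟩
  · rw [injective_iff_map_eq_zero]
    intro a h
    by_contra ha
    exact φ.toRingHom_ne_zero ha (congrArg Subtype.val h)

/-- If `End_k(φ)` is a Dedekind domain then `k{τ} I ∩ End_k(φ) = I` for each nonzero ideal `I`. -/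
theorem mem_of_mem_leftSpan
    (hded : letI := endCommRing φ hcomm; IsDedekindDomain (EndRing p m Fq k hFq φ))
    {I : Set (AddMonoid.End (Kb k))} (hI : IsIdealOf k (EndRing p m Fq k hFq φ) I)
    (hI0 : I ≠ {0}) {x : AddMonoid.End (Kb k)} (hx : x ∈ leftSpan p m Fq k hFq I)
    (hxE : x ∈ EndRing p m Fq k hFq φ) : x ∈ I := by
  let := endCommRing φ hcomm
  obtain ⟨hIE, hzero, hadd, -, hmul, -⟩ := hI
  let J : Ideal (EndRing p m Fq k hFq φ) :=
    { carrier := {z | (z : AddMonoid.End (Kb k)) ∈ I}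
      add_mem' := fun {a b} ha hb => hadd a ha b hb
      zero_mem' := hzero
      smul_mem' := fun c z hz => hmul c c.2 z hz }
  obtain ⟨e, heI, he0⟩ : ∃ e ∈ I, e ≠ 0 := by
    by_contra! h
    exact hI0 (Set.eq_singleton_iff_unique_mem.mpr ⟨hzero, h⟩)
  let e' : EndRing p m Fq k hFq φ := ⟨e, hIE heI⟩
  have he'0 : e' ≠ 0 := fun h => he0 (congrArg Subtype.val h)
  obtain ⟨L, hL⟩ : J ∣ Ideal.span {e'} :=
    Ideal.dvd_iff_le.mpr ((Ideal.span_singleton_le_iff_mem J).mpr heI)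
  have hL0 : L ≠ 0 := by
    rintro rfl
    rw [mul_zero] at hL
    exact he'0 (Ideal.span_singleton_eq_bot.mp hL)
  suffices h : Ideal.span {(⟨x, hxE⟩ : EndRing p m Fq k hFq φ)} * L ≤ J * L from
    (Ideal.span_singleton_le_iff_mem J).mp
      (Ideal.dvd_iff_le.mp ((mul_dvd_mul_iff_right hL0).mp (Ideal.dvd_iff_le.mpr h)))
  rw [← hL, Ideal.span_singleton_mul_le_iff]
  intro y hy
  obtain ⟨w, hw, hxy⟩ := exists_mul_eq_mul_of_mem_leftSpan (y := y) (e := e) (fun z hz => by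
    have hzy : (⟨z, hIE hz⟩ : EndRing p m Fq k hFq φ) * y ∈ Ideal.span {e'} :=
      hL ▸ Ideal.mul_mem_mul hz hy
    obtain ⟨c, hc⟩ := Ideal.mem_span_singleton'.mp hzy
    exact ⟨c, c.2.1, (congrArg Subtype.val hc).symm⟩) hx
  refine Ideal.mem_span_singleton'.mpr ⟨⟨w, ?_⟩, Subtype.ext hxy.symm⟩
  exact mem_endRing_of_mul_mem φ hw (hIE heI) he0 (hxy ▸ mul_mem hxE y.2)

end DrinfeldModule

end Drinfeld

namespace Drinfeld

/-- Assume `E = End_k(φ)` (commutative) is the maximal `A`-order in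
`D = E ⊗_A F = Frac(E)`, i.e. `E` equals the integral closure of `A` in `D`.  (Elements of
`D` are encoded as fractions `e/φ_a` with `e ∈ E`, `0 ≠ a ∈ A`; such an element is integral
over `A` iff it satisfies a monic equation `x^N + Σ_{i<N} c_i x^i = 0` with `c_i ∈ A`, which
after clearing denominators reads `e^N + Σ_{i<N} φ(c_i) e^i φ(a)^{N-i} = 0`; it lies in `E`
iff `e = e'·φ_a` for some `e' ∈ E`.)  Then every nonzero ideal of `E` is a kernel ideal. -/
theorem statement16
    (p m : ℕ) [Fact p.Prime] (Fq k : Type) [Field Fq] [Fintype Fq]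
    [Field k] [Fintype k] [CharP k p] (hFq : Fintype.card Fq = p ^ m)
    (γ : Polynomial Fq →+* k) (r : ℕ) (φ : DrinfeldModule p m Fq k hFq γ r)
    (hcomm : ∀ x ∈ EndRing p m Fq k hFq φ, ∀ y ∈ EndRing p m Fq k hFq φ, x * y = y * x)
    (hmax : ∀ e ∈ EndRing p m Fq k hFq φ, ∀ a : Polynomial Fq, a ≠ 0 →
      (∃ N : ℕ, 0 < N ∧ ∃ c : ℕ → Polynomial Fq,
        e ^ N + ∑ i ∈ Finset.range N,
          φ.toRingHom (c i) * e ^ i * φ.toRingHom a ^ (N - i) = 0) →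
      ∃ e' ∈ EndRing p m Fq k hFq φ, e = e' * φ.toRingHom a) :
    ∀ I : Set (AddMonoid.End (Kb k)),
      IsIdealOf k (EndRing p m Fq k hFq φ) I → I ≠ {0} →
        IsKernelIdeal p m Fq k hFq φ I := by
  intro I hI hI0
  ext x
  refine ⟨fun ⟨hx, a, ha, hxa⟩ => ?_, fun hx => ⟨?_, 1, one_ne_zero, ?_⟩⟩
  · have hxE : x ∈ EndRing p m Fq k hFq φ :=
      mem_endRing_of_mul_mem φ (leftSpan_subset_skewPoly (fun y hy => (hI.1 hy).1) hx)
        (φ.toRingHom_mem_endRing a) (φ.toRingHom_ne_zero ha) hxa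
    exact mem_of_mem_leftSpan φ hcomm (isDedekindDomain_endRing φ hcomm hmax) hI hI0 hx hxE
  · exact AddSubgroup.subset_closure ⟨1, one_mem _, x, hx, (one_mul x).symm⟩
  · rw [map_one, mul_one]
    exact hI.1 hx

end Drinfeld
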